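/- Let e₁, e₂ ⊆ E_m with |e₁| = |e₂|. Then the design O_m ∪ e₁ has smaller aberration than the design O_m ∪ e₂ if and only if e₁ has smaller aberration than e₂. -/

import Mathlib

open Finset Polynomial

/-- The ambient 𝔽₂-vector space `V = (ZMod 2)^m`. -/
abbrev V (m : ℕ) := Fin m → ZMod 2

/-- `Hm m` is the set of the `2^m - 1` nonzero vectors of `V m`. -/
def Hm (m : ℕ) : Finset (V m) := Finset.univ.filter (fun v => v ≠ 0)

/-- `Om m` is the set of odd-weight vectors of `V m`. -/
def Om (m : ℕ) : Finset (V m) := Finset.univ.filter (fun v => (∑ i, v i) = 1)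

/-- `Em m` is the set of nonzero even-weight vectors of `V m`. -/
def Em (m : ℕ) : Finset (V m) := Finset.univ.filter (fun v => v ≠ 0 ∧ (∑ i, v i) = 0)

/-- The number of `i`-element subsets of `d` whose elements sum to `ψ`. -/
def sumCount (m : ℕ) (d : Finset (V m)) (i : ℕ) (ψ : V m) : ℕ :=
  ((d.powersetCard i).filter (fun S => S.sum id = ψ)).card

/-- `wordCount m d i = a_i(d)`, the number of `i`-element subsets of `d` summing to `0`. -/
def wordCount (m : ℕ) (d : Finset (V m)) (i : ℕ) : ℕ := sumCount m d i 0

/-- The rank of a finite set of vectors: the dimension of its span over `𝔽₂`. -/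
noncomputable def rankOf (m : ℕ) (f : Finset (V m)) : ℕ :=
  Module.finrank (ZMod 2) (Submodule.span (ZMod 2) (f : Set (V m)))

/-- `d₁` has smaller aberration than `d₂`. -/
def SmallerAberration (m : ℕ) (d₁ d₂ : Finset (V m)) : Prop :=
  ∃ s, 1 ≤ s ∧ wordCount m d₁ s < wordCount m d₂ s ∧
    ∀ t < s, wordCount m d₁ t = wordCount m d₂ t

/-- `d` is a minimum aberration design. -/
def IsMA (m : ℕ) (d : Finset (V m)) : Prop :=
  d ⊆ Hm m ∧ ∀ d' ⊆ Hm m, d'.card = d.card → ¬ SmallerAberration m d' d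

/-- The word-length pattern polynomial `P_f(X) = ∑ a_i(f) X^i` of a design `f`. -/
noncomputable def WLPP (m : ℕ) (f : Finset (V m)) : Polynomial ℤ :=
  ∑ i ∈ Finset.range (f.card + 1), (wordCount m f i : ℤ) • X ^ i

/-- `Q_ψ(X) = ∑ q_i(ψ) X^i`, where `q_i(ψ)` counts `i`-element subsets of `O_m` summing to `ψ`. -/
noncomputable def Qpoly (m : ℕ) (ψ : V m) : Polynomial ℤ :=
  ∑ i ∈ Finset.range ((Om m).card + 1), (sumCount m (Om m) i ψ : ℤ) • X ^ i

lemma add_self_eq_zero_of_V {m : ℕ} (v : V m) : v + v = 0 := by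
  ext i
  exact CharTwo.add_self_eq_zero (v i)

lemma eq_of_add_eq_zero_of_V {m : ℕ} {u v : V m} (h : u + v = 0) : u = v := by
  rw [add_eq_zero_iff_eq_neg] at h
  rw [h, neg_eq_iff_add_eq_zero]
  exact add_self_eq_zero_of_V v

/-- Splitting the words of a disjoint union according to their intersections with the parts. -/
lemma wordCount_union {m : ℕ} {d e : Finset (V m)} (hde : Disjoint d e) (n : ℕ) :
    wordCount m (d ∪ e) n =
      ∑ p ∈ antidiagonal n, ∑ T ∈ e.powersetCard p.1, sumCount m d p.2 (T.sum id) := by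
  simp only [wordCount, sumCount, ← card_sigma]
  refine card_bij' (fun S _ => ⟨((S ∩ e).card, (S ∩ d).card), S ∩ e, S ∩ d⟩)
    (fun x _ => x.2.2 ∪ x.2.1) ?_ ?_ ?_ ?_
  · intro S hS
    simp only [mem_filter, mem_powersetCard] at hS
    obtain ⟨⟨hSs, hSn⟩, hS0⟩ := hS
    have hu : S ∩ e ∪ S ∩ d = S := by
      rw [← inter_union_distrib_left, union_comm, inter_eq_left.2 hSs]
    have hd : Disjoint (S ∩ e) (S ∩ d) :=
      hde.symm.mono inter_subset_right inter_subset_right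
    simp only [mem_sigma, HasAntidiagonal.mem_antidiagonal, mem_powersetCard, mem_filter, inter_subset_right,
      and_self, true_and]
    refine ⟨by rw [← card_union_of_disjoint hd, hu, hSn], ?_⟩
    rw [← hu, sum_union hd] at hS0
    exact (eq_of_add_eq_zero_of_V hS0).symm
  · rintro ⟨⟨i, j⟩, T, U⟩ hx
    simp only [mem_sigma, HasAntidiagonal.mem_antidiagonal, mem_powersetCard, mem_filter] at hx ⊢
    obtain ⟨hij, ⟨hT, hTc⟩, ⟨hU, hUc⟩, hs⟩ := hx
    have hd : Disjoint U T := hde.mono hU hT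
    refine ⟨⟨union_subset_union hU hT, by rw [card_union_of_disjoint hd]; omega⟩, ?_⟩
    rw [sum_union hd, hs, add_self_eq_zero_of_V]
  · intro S hS
    simp only [mem_filter, mem_powersetCard] at hS
    rw [← inter_union_distrib_left, inter_eq_left.2 hS.1.1]
  · rintro ⟨⟨i, j⟩, T, U⟩ hx
    simp only [mem_sigma, HasAntidiagonal.mem_antidiagonal, mem_powersetCard, mem_filter] at hx
    obtain ⟨hij, ⟨hT, rfl⟩, ⟨hU, rfl⟩, hs⟩ := hx
    have h1 : (U ∪ T) ∩ e = T := by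
      rw [union_inter_distrib_right, inter_eq_left.2 hT,
        disjoint_iff_inter_eq_empty.1 (hde.mono_left hU), empty_union]
    have h2 : (U ∪ T) ∩ d = U := by
      rw [union_inter_distrib_right, inter_eq_left.2 hU,
        disjoint_iff_inter_eq_empty.1 (hde.symm.mono_left hT), union_empty]
    simp only [h1, h2]

/-- An additive map that permutes `d` preserves the counts of subsets of `d` with given sum. -/
lemma sumCount_le_of_addMonoidHom {m : ℕ} {d : Finset (V m)} (g : V m →+ V m)
    (hg : Function.Injective g) (hd : ∀ v ∈ d, g v ∈ d) (i : ℕ) (ψ : V m) :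
    sumCount m d i ψ ≤ sumCount m d i (g ψ) := by
  refine card_le_card_of_injOn (fun S => S.image g) ?_ ((image_injective hg).injOn)
  intro S hS
  simp only [coe_filter, mem_powersetCard, Set.mem_ofPred_eq] at hS ⊢
  obtain ⟨⟨hS, hc⟩, rfl⟩ := hS
  refine ⟨⟨fun v hv => ?_, by rw [card_image_of_injective _ hg, hc]⟩, ?_⟩
  · obtain ⟨u, hu, rfl⟩ := mem_image.1 hv
    exact hd u (hS hu)
  · rw [sum_image hg.injOn, map_sum]
    rfl

/-- Two nonzero vectors over `𝔽₂` are both sent to `1` by some functional. -/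
lemma exists_functional_eq_one {m : ℕ} {u v : V m} (hu : u ≠ 0) (hv : v ≠ 0) :
    ∃ f : V m →+ ZMod 2, f u = 1 ∧ f v = 1 := by
  have key : ∀ x : ZMod 2, x ≠ 0 → x = 1 := by decide
  have key' : ∀ x : ZMod 2, x ≠ 1 → x = 0 := by decide
  obtain ⟨i, hi⟩ := Function.ne_iff.1 hu
  obtain ⟨j, hj⟩ := Function.ne_iff.1 hv
  replace hi := key _ hi
  replace hj := key _ hj
  let p (k : Fin m) : V m →+ ZMod 2 := Pi.evalAddMonoidHom _ k
  by_cases h1 : v i = 1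
  · exact ⟨p i, hi, h1⟩
  by_cases h2 : u j = 1
  · exact ⟨p j, h2, hj⟩
  refine ⟨p i + p j, ?_, ?_⟩
  · change u i + u j = 1
    rw [hi, key' _ h2, add_zero]
  · change v i + v j = 1
    rw [hj, key' _ h1, zero_add]

/-- The transvection `v ↦ v + f v • (ψ + φ)` shows that the number of subsets of `O_m` with sum
`ψ` is the same for all `ψ ∈ E_m`. -/
lemma sumCount_Om_le {m : ℕ} {ψ φ : V m} (hψ : ψ ∈ Em m) (hφ : φ ∈ Em m) (i : ℕ) :
    sumCount m (Om m) i ψ ≤ sumCount m (Om m) i φ := by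
  simp only [Em, mem_filter, mem_univ, true_and] at hψ hφ
  obtain ⟨f, hfψ, hfφ⟩ := exists_functional_eq_one hψ.1 hφ.1
  let g : V m →+ V m :=
    { toFun := fun v => v + f v • (ψ + φ)
      map_zero' := by simp
      map_add' := fun u v => by rw [map_add, add_smul]; abel }
  have hgv (v : V m) : g v = v + f v • (ψ + φ) := rfl
  have hfg (v : V m) : f (g v) = f v := by
    have hs : f (ψ + φ) = 0 := by rw [map_add, hfψ, hfφ]; rfl
    have : ∀ c : ZMod 2, f (c • (ψ + φ)) = 0 := by
      intro c
      rcases (by revert c; decide : ∀ c : ZMod 2, c = 0 ∨ c = 1) c with rfl | rfl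
      · rw [zero_smul, map_zero]
      · rw [one_smul, hs]
    rw [hgv, map_add, this, add_zero]
  have hinj : Function.Injective g := by
    intro u v huv
    have hf : f u = f v := by rw [← hfg u, huv, hfg]
    rw [hgv, hgv, hf] at huv
    exact add_right_cancel huv
  have hgψ : g ψ = φ := by
    rw [hgv, hfψ, one_smul, ← add_assoc, add_self_eq_zero_of_V, zero_add]
  rw [← hgψ]
  refine sumCount_le_of_addMonoidHom g hinj (fun v hv => ?_) i ψ
  simp only [Om, mem_filter, mem_univ, true_and] at hv ⊢
  simp [hgv, sum_add_distrib, ← mul_sum, hv, hψ.2, hφ.2]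

lemma sumCount_zero_right {m : ℕ} (d : Finset (V m)) (ψ : V m) :
    sumCount m d 0 ψ = if ψ = 0 then 1 else 0 := by
  by_cases h : ψ = 0 <;> simp [sumCount, filter_singleton, h, eq_comm]

lemma exists_sumCount_Om_eq (m : ℕ) :
    ∃ r : ℕ → ℕ, r 0 = 0 ∧ ∀ ψ ∈ Em m, ∀ i, sumCount m (Om m) i ψ = r i := by
  rcases (Em m).eq_empty_or_nonempty with h | ⟨φ, hφ⟩
  · exact ⟨0, rfl, by simp [h]⟩
  · refine ⟨fun i => sumCount m (Om m) i φ, ?_, fun ψ hψ i =>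
      (sumCount_Om_le hψ hφ i).antisymm (sumCount_Om_le hφ hψ i)⟩
    have : φ ≠ 0 := (mem_filter.1 hφ).2.1
    simp [sumCount_zero_right, this]

lemma sum_mem_Em_of_ne_zero {m : ℕ} {T : Finset (V m)} (hT : T ⊆ Em m) (h0 : T.sum id ≠ 0) :
    T.sum id ∈ Em m := by
  simp only [Em, mem_filter, mem_univ, true_and]
  refine ⟨h0, ?_⟩
  simp only [Finset.sum_apply, id]
  rw [sum_comm]
  exact sum_eq_zero fun v hv => (mem_filter.1 (hT hv)).2.2

lemma disjoint_Om_Em (m : ℕ) : Disjoint (Om m) (Em m) := by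
  rw [disjoint_left]
  intro v hv hv'
  have h1 := (mem_filter.1 hv).2
  have h0 := (mem_filter.1 hv').2.2
  exact zero_ne_one (h0.symm.trans h1)

/-- The coefficients of `P_{O_m ∪ e} = (Q_0 - Q_1) P_e + (1 + X)^{|e|} Q_1`, where `Q_1` has
coefficients `r`. -/
lemma wordCount_Om_union {m : ℕ} {r : ℕ → ℕ}
    (hr : ∀ ψ ∈ Em m, ∀ i, sumCount m (Om m) i ψ = r i) {e : Finset (V m)} (he : e ⊆ Em m)
    (n : ℕ) :
    (wordCount m (Om m ∪ e) n : ℤ) =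
      ∑ p ∈ antidiagonal n, (wordCount m e p.1 : ℤ) * (wordCount m (Om m) p.2 - r p.2) +
        ∑ p ∈ antidiagonal n, (e.card.choose p.1 : ℤ) * r p.2 := by
  rw [wordCount_union ((disjoint_Om_Em m).mono_right he), ← sum_add_distrib]
  push_cast
  refine sum_congr rfl fun p _ => ?_
  have h : ∀ T ∈ e.powersetCard p.1, (sumCount m (Om m) p.2 (T.sum id) : ℤ) =
      (if T.sum id = 0 then 1 else 0) * ((wordCount m (Om m) p.2 : ℤ) - r p.2) + r p.2 := by
    intro T hT
    split_ifs with h0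
    · rw [h0, wordCount]; ring
    · rw [hr _ (sum_mem_Em_of_ne_zero ((mem_powersetCard.1 hT).1.trans he) h0)]; ring
  rw [sum_congr rfl h, sum_add_distrib, ← sum_mul, sum_boole, sum_const, card_powersetCard,
    nsmul_eq_mul]
  rfl

/-- For `c 0 = 1`, convolution with `c` preserves the leading term of a sequence. -/
lemma sum_antidiagonal_mul_eq_of_forall_lt {f c : ℕ → ℤ} (hc : c 0 = 1) {n : ℕ}
    (hf : ∀ t < n, f t = 0) : ∑ p ∈ antidiagonal n, f p.1 * c p.2 = f n := by
  rw [sum_eq_single_of_mem (n, 0) (by simp), hc, mul_one]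
  rintro ⟨i, j⟩ hp hne
  rw [HasAntidiagonal.mem_antidiagonal] at hp
  have hi : i < n := by
    refine lt_of_le_of_ne (by omega) fun h => hne ?_
    ext <;> omega
  rw [hf i hi, zero_mul]

/-- For `e₁, e₂ ⊆ E_m` of equal cardinality, `O_m ∪ e₁` has smaller
aberration than `O_m ∪ e₂` if and only if `e₁` has smaller aberration than `e₂`. -/
theorem smaller_aberration_union_iff (m : ℕ) (hm : 2 ≤ m)
    (e₁ e₂ : Finset (V m)) (he₁ : e₁ ⊆ Em m) (he₂ : e₂ ⊆ Em m)
    (hcard : e₁.card = e₂.card) :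
    SmallerAberration m (Om m ∪ e₁) (Om m ∪ e₂) ↔ SmallerAberration m e₁ e₂ := by
  obtain ⟨r, hr0, hr⟩ := exists_sumCount_Om_eq m
  let f (n : ℕ) : ℤ := wordCount m e₁ n - wordCount m e₂ n
  let c (n : ℕ) : ℤ := wordCount m (Om m) n - r n
  have hc : c 0 = 1 := by simp [c, hr0, wordCount, sumCount_zero_right]
  have hconv (n : ℕ) : (wordCount m (Om m ∪ e₁) n : ℤ) - wordCount m (Om m ∪ e₂) n =
      ∑ p ∈ antidiagonal n, f p.1 * c p.2 := by
    rw [wordCount_Om_union hr he₁, wordCount_Om_union hr he₂, hcard, add_sub_add_right_eq_sub,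
      ← sum_sub_distrib]
    exact sum_congr rfl fun p _ => (sub_mul _ _ _).symm
  have hlead (n : ℕ) (h : ∀ t < n, f t = 0) :
      (wordCount m (Om m ∪ e₁) n : ℤ) - wordCount m (Om m ∪ e₂) n = f n := by
    rw [hconv, sum_antidiagonal_mul_eq_of_forall_lt hc h]
  have hagree (s : ℕ) : (∀ t < s, wordCount m (Om m ∪ e₁) t = wordCount m (Om m ∪ e₂) t) ↔
      ∀ t < s, f t = 0 := by
    constructor
    · intro h t
      induction t using Nat.strong_induction_on with
      | _ t ih =>
        intro ht
        rw [← hlead t fun u hu => ih u hu (hu.trans ht), h t ht, sub_self]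
    · intro h t ht
      have := hlead t fun u hu => h u (hu.trans ht)
      rw [h t ht] at this
      omega
  have hf (t : ℕ) : f t = 0 ↔ wordCount m e₁ t = wordCount m e₂ t := by
    simp only [f]
    omega
  refine exists_congr fun s => and_congr_right fun _ => ?_
  simp only [hagree s, ← hf]
  refine and_congr_left fun h => ?_
  have := hlead s h
  simp only [f] at this
  omega
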